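/- arXiv:2304.04736 — 2 statements merged into one kernel-verified Lean document; each statement's English description precedes it below -/
import Mathlib

section
/- Let S be a measurable space and let m and h be probability measures on S with δ := TV(m, h) > 0. Let ε ∈ [1/2, 1). If the natural number n satisfies n ≥ (1/δ²)·log(2/(1 − ε)), then 1/2 + T_n − T_n²/2 ≥ ε, where T_n = TV(m^⊗n, h^⊗n); that is, the AUROC achievable by the best (likelihood-ratio-based) detector on n i.i.d. samples is at least ε. (Theorem: sample complexity of AI-generated text detection, i.i.d. case.) -/
open MeasureTheory

/-- Total variation distance: supremum over measurable sets of the difference of measures. -/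
noncomputable def TVdist {S : Type*} [MeasurableSpace S]
    (m h : Measure S) : ℝ :=
  ⨆ B : {B : Set S // MeasurableSet B}, ((m B.1).toReal - (h B.1).toReal)

open ProbabilityTheory in
/-- Hoeffding's inequality for a function with values in an interval of length one, evaluated on
the coordinates of a product measure. -/
theorem measureReal_pi_sum_sub_integral_ge_le {S : Type*} [MeasurableSpace S] (μ : Measure S)
    [IsProbabilityMeasure μ] {f : S → ℝ} (hf : Measurable f) {a : ℝ}
    (hfa : ∀ x, f x ∈ Set.Icc a (a + 1)) (n : ℕ) {t : ℝ} (ht : 0 ≤ t) :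
    (Measure.pi fun _ : Fin n => μ).real {ω | n * t ≤ ∑ i, (f (ω i) - ∫ x, f x ∂μ)}
      ≤ Real.exp (-2 * n * t ^ 2) := by
  have hsub : ∀ i : Fin n, HasSubgaussianMGF (fun ω : Fin n → S => f (ω i) - ∫ x, f x ∂μ)
      ((‖(a + 1) - a‖₊ / 2) ^ 2) (Measure.pi fun _ : Fin n => μ) := by
    intro i
    have hi : ∫ ω : Fin n → S, f (ω i) ∂(Measure.pi fun _ : Fin n => μ) = ∫ x, f x ∂μ :=
      integral_comp_eval (μ := fun _ : Fin n => μ) hf.aestronglyMeasurable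
    rw [← hi]
    exact hasSubgaussianMGF_of_mem_Icc (hf.comp (measurable_pi_apply i)).aemeasurable
      (ae_of_all _ fun ω => hfa (ω i))
  have hind : iIndepFun (fun (i : Fin n) (ω : Fin n → S) => f (ω i) - ∫ x, f x ∂μ)
      (Measure.pi fun _ : Fin n => μ) :=
    iIndepFun_pi (μ := fun _ : Fin n => μ) (X := fun _ x => f x - ∫ x, f x ∂μ)
      fun _ => (hf.sub_const _).aemeasurable
  rcases n.eq_zero_or_pos with rfl | hn
  · simp
  refine (HasSubgaussianMGF.measure_sum_ge_le_of_iIndepFun hind (s := Finset.univ)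
    (fun i _ => hsub i) (by positivity)).trans_eq ?_
  have : (n : ℝ) ≠ 0 := by positivity
  congr 1
  simp
  field_simp

theorem TVdist_bddAbove {S : Type*} [MeasurableSpace S] (m h : Measure S)
    [IsProbabilityMeasure m] :
    BddAbove (Set.range fun B : {B : Set S // MeasurableSet B} =>
      (m B.1).toReal - (h B.1).toReal) := by
  refine ⟨1, ?_⟩
  rintro _ ⟨B, rfl⟩
  have h₁ : (m B.1).toReal ≤ 1 := measureReal_le_one
  have h₂ : 0 ≤ (h B.1).toReal := ENNReal.toReal_nonneg
  simp only
  linarith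

theorem TVdist_le_one {S : Type*} [MeasurableSpace S] (m h : Measure S)
    [IsProbabilityMeasure m] : TVdist m h ≤ 1 := by
  have : Nonempty {B : Set S // MeasurableSet B} := ⟨⟨∅, .empty⟩⟩
  refine ciSup_le fun B => ?_
  have h₁ : (m B.1).toReal ≤ 1 := measureReal_le_one
  have h₂ : 0 ≤ (h B.1).toReal := ENNReal.toReal_nonneg
  linarith

/-- Counting how many samples fall in `B` separates the product measures. -/
theorem one_sub_exp_le_TVdist_pi_of_measurableSet {S : Type*} [MeasurableSpace S]
    (m h : Measure S) [IsProbabilityMeasure m] [IsProbabilityMeasure h] {B : Set S}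
    (hB : MeasurableSet B) (hd : 0 ≤ m.real B - h.real B) (n : ℕ) :
    1 - 2 * Real.exp (-n * (m.real B - h.real B) ^ 2 / 2)
      ≤ TVdist (Measure.pi fun _ : Fin n => m) (Measure.pi fun _ : Fin n => h) := by
  set f : S → ℝ := B.indicator 1 with hf
  have hfm : Measurable f := measurable_one.indicator hB
  have hf01 : ∀ x, 0 ≤ f x ∧ f x ≤ 1 := fun x => by
    by_cases hx : x ∈ B <;> simp [hf, hx]
  have hfint : ∀ μ : Measure S, ∫ x, f x ∂μ = μ.real B := fun μ => integral_indicator_one hB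
  have hh := measureReal_pi_sum_sub_integral_ge_le h hfm (a := 0)
    (fun x => by simpa using hf01 x) n (div_nonneg hd zero_le_two)
  have hm := measureReal_pi_sum_sub_integral_ge_le m hfm.neg (a := -1)
    (fun x => by simpa using (hf01 x).symm) n (div_nonneg hd zero_le_two)
  simp only [Pi.neg_apply, integral_neg, hfint, Finset.sum_sub_distrib, Finset.sum_neg_distrib,
    Finset.sum_const, Finset.card_univ, Fintype.card_fin, nsmul_eq_mul] at hh hm
  set A : Set (Fin n → S) :=
    {ω | n * ((m.real B - h.real B) / 2) ≤ ∑ i, f (ω i) - n * h.real B} with hA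
  have hAm : MeasurableSet A := measurableSet_le measurable_const
    ((Finset.measurable_sum _ fun i _ => hfm.comp (measurable_pi_apply i)).sub_const _)
  have hAc : (Measure.pi fun _ : Fin n => m).real Aᶜ
      ≤ Real.exp (-2 * n * ((m.real B - h.real B) / 2) ^ 2) := by
    refine (measureReal_mono fun ω hω => ?_).trans hm
    simp only [hA, Set.mem_compl_iff, Set.mem_ofPred_eq, not_le] at hω ⊢
    linarith
  rw [probReal_compl_eq_one_sub hAm] at hAc
  have hle := le_ciSup (TVdist_bddAbove (Measure.pi fun _ : Fin n => m)
    (Measure.pi fun _ : Fin n => h)) ⟨A, hAm⟩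
  have he : -2 * n * ((m.real B - h.real B) / 2) ^ 2
      = -n * (m.real B - h.real B) ^ 2 / 2 := by ring
  rw [he] at hh hAc
  refine le_trans ?_ hle
  simp only [← measureReal_def]
  linarith

theorem one_sub_exp_le_TVdist_pi {S : Type*} [MeasurableSpace S] (m h : Measure S)
    [IsProbabilityMeasure m] [IsProbabilityMeasure h] (hδ : 0 < TVdist m h) (n : ℕ) :
    1 - 2 * Real.exp (-n * TVdist m h ^ 2 / 2)
      ≤ TVdist (Measure.pi fun _ : Fin n => m) (Measure.pi fun _ : Fin n => h) := by
  have : Nonempty {B : Set S // MeasurableSet B} := ⟨⟨∅, .empty⟩⟩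
  have hcont : Filter.Tendsto (fun d : ℝ => 1 - 2 * Real.exp (-n * d ^ 2 / 2))
      (nhdsWithin (TVdist m h) (Set.Iio (TVdist m h)))
      (nhds (1 - 2 * Real.exp (-n * TVdist m h ^ 2 / 2))) :=
    (by fun_prop : Continuous fun d : ℝ => 1 - 2 * Real.exp (-n * d ^ 2 / 2)).continuousWithinAt
  refine le_of_tendsto hcont ?_
  filter_upwards [Ioo_mem_nhdsLT hδ] with d hd
  obtain ⟨B, hdB⟩ := exists_lt_of_lt_ciSup hd.2
  simp only [← measureReal_def] at hdB
  refine le_trans ?_ (one_sub_exp_le_TVdist_pi_of_measurableSet m h B.2 (hd.1.trans hdB).le n)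
  have := hd.1.le
  rw [neg_mul, neg_mul]
  gcongr

/-- Sample complexity of AI-generated text detection (i.i.d. case): if
`δ = TV(m, h) > 0`, `ε ∈ [1/2, 1)`, and `n ≥ (1/δ²)·log(2/(1 − ε))`, then the AUROC
of the best detector on `n` i.i.d. samples, `1/2 + Tₙ − Tₙ²/2` with
`Tₙ = TV(m^⊗n, h^⊗n)`, is at least `ε`. -/
theorem sample_complexity_iid {S : Type*} [MeasurableSpace S]
    (m h : Measure S) [IsProbabilityMeasure m] [IsProbabilityMeasure h]
    (hδ : 0 < TVdist m h) (ε : ℝ) (hε : ε ∈ Set.Ico (1 / 2 : ℝ) 1)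
    (n : ℕ)
    (hn : (n : ℝ) ≥ (1 / (TVdist m h) ^ 2) * Real.log (2 / (1 - ε))) :
    1 / 2
      + TVdist (Measure.pi fun _ : Fin n => m) (Measure.pi fun _ : Fin n => h)
      - (TVdist (Measure.pi fun _ : Fin n => m) (Measure.pi fun _ : Fin n => h)) ^ 2 / 2
      ≥ ε := by
  have ha : 0 < 1 - ε := by linarith [hε.2]
  have hT := one_sub_exp_le_TVdist_pi m h hδ n
  have hT1 := TVdist_le_one (Measure.pi fun _ : Fin n => m) (Measure.pi fun _ : Fin n => h)
  set T := TVdist (Measure.pi fun _ : Fin n => m) (Measure.pi fun _ : Fin n => h)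
  have hlog : Real.log (2 / (1 - ε)) ≤ n * TVdist m h ^ 2 := by
    rwa [ge_iff_le, one_div_mul_eq_div, div_le_iff₀ (by positivity)] at hn
  have hexp : Real.exp (-n * TVdist m h ^ 2 / 2) ^ 2 ≤ (1 - ε) / 2 := by
    rw [← Real.exp_nat_mul]
    calc Real.exp ((2 : ℕ) * (-n * TVdist m h ^ 2 / 2))
        ≤ Real.exp (-Real.log (2 / (1 - ε))) := by
          gcongr
          push_cast
          linarith
      _ = (1 - ε) / 2 := by rw [Real.exp_neg, Real.exp_log (by positivity), inv_div]
  nlinarith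
end

section
/- Let S be a measurable space and let m and h be probability measures on S with δ := TV(m, h) > 0. Let ε ∈ [1/2, 1). If the natural number n satisfies n ≥ (1/δ²)·log(2/(1 − ε)), then there exists a measurable set A ⊆ S^n such that m^⊗n(Aᶜ) + h^⊗n(A) ≤ √(2·(1 − ε)); that is, a detector on n i.i.d. samples whose total error probability is at most √(2(1−ε)). -/
open MeasureTheory

/-- The supremum in the total variation distance of two finite measures is attained. -/
lemma exists_measurableSet_TVdist_eq {S : Type*} [MeasurableSpace S]
    (m h : Measure S) [IsFiniteMeasure m] [IsFiniteMeasure h] :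
    ∃ B : Set S, MeasurableSet B ∧ TVdist m h = m.real B - h.real B := by
  obtain ⟨B, hB, hle, hge⟩ := hahn_decomposition m h
  have key (t : Set S) (ht : MeasurableSet t) :
      m.real t - h.real t ≤ m.real B - h.real B := by
    have h₁ : h.real (B \ t) ≤ m.real (B \ t) :=
      ENNReal.toReal_mono (by finiteness) (hle _ (hB.diff ht) Set.sdiff_subset)
    have h₂ : m.real (t \ B) ≤ h.real (t \ B) :=
      ENNReal.toReal_mono (by finiteness) (hge _ (ht.diff hB) fun _ hx => hx.2)
    have m₁ := measureReal_inter_add_sdiff (μ := m) (s := t) hB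
    have m₂ := measureReal_inter_add_sdiff (μ := m) (s := B) ht
    have k₁ := measureReal_inter_add_sdiff (μ := h) (s := t) hB
    have k₂ := measureReal_inter_add_sdiff (μ := h) (s := B) ht
    rw [Set.inter_comm] at m₂ k₂
    linarith
  refine ⟨B, hB, le_antisymm ?_ ?_⟩
  · have : Nonempty {B : Set S // MeasurableSet B} := ⟨⟨B, hB⟩⟩
    exact ciSup_le fun t => key t.1 t.2
  · exact le_ciSup (f := fun t : {B : Set S // MeasurableSet B} =>
      (m t.1).toReal - (h t.1).toReal)
      ⟨m.real B - h.real B, by rintro _ ⟨t, rfl⟩; exact key t.1 t.2⟩ ⟨B, hB⟩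

/-- **Hoeffding's inequality** for the empirical sum of a bounded function under a product
measure. -/
lemma measureReal_pi_sum_ge_le_exp {S : Type*} [MeasurableSpace S]
    (μ : Measure S) [IsProbabilityMeasure μ] {f : S → ℝ} (hf : Measurable f) {a b : ℝ}
    (hab : ∀ x, f x ∈ Set.Icc a b) (n : ℕ) {t : ℝ} (ht : 0 ≤ t) :
    (Measure.pi fun _ : Fin n => μ).real {x | n * (∫ y, f y ∂μ + t) ≤ ∑ i, f (x i)} ≤
      Real.exp (-(2 * n * t ^ 2 / (b - a) ^ 2)) := by
  have hindep := ProbabilityTheory.iIndepFun_pi (ι := Fin n) (μ := fun _ => μ)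
    (X := fun _ y => f y - ∫ y, f y ∂μ) (fun _ => (hf.sub_const _).aemeasurable)
  have hsub (i : Fin n) : ProbabilityTheory.HasSubgaussianMGF
      (fun x : Fin n → S => f (x i) - ∫ y, f y ∂μ) ((‖b - a‖₊ / 2) ^ 2)
      (Measure.pi fun _ => μ) := by
    have := ProbabilityTheory.hasSubgaussianMGF_of_mem_Icc
      (μ := Measure.pi fun _ : Fin n => μ) (X := fun x => f (x i)) (a := a) (b := b)
      (hf.comp (measurable_pi_apply i)).aemeasurable (ae_of_all _ fun x => hab (x i))
    rwa [integral_comp_eval (μ := fun _ : Fin n => μ) hf.aestronglyMeasurable] at this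
  have key := ProbabilityTheory.HasSubgaussianMGF.measure_sum_ge_le_of_iIndepFun hindep
    (s := Finset.univ) (fun i _ => hsub i) (ε := n * t) (by positivity)
  convert key using 2
  · ext x
    simp only [Set.mem_ofPred_eq, Finset.sum_sub_distrib, Finset.sum_const, Finset.card_univ,
      Fintype.card_fin, nsmul_eq_mul, mul_add, le_sub_iff_add_le']
  · simp only [Finset.sum_const, Finset.card_univ, Fintype.card_fin, nsmul_eq_mul]
    push_cast
    rw [Real.norm_eq_abs, div_pow, sq_abs]
    rcases eq_or_ne (n : ℝ) 0 with hn | hn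
    · simp [hn]
    rcases eq_or_ne (b - a) 0 with hc | hc
    · simp [hc]
    field_simp

/-- If `δ = TV(m, h) > 0`, `ε ∈ [1/2, 1)`, and `n ≥ (1/δ²)·log(2/(1 − ε))`, then there
is a detector (acceptance region) on `n` i.i.d. samples whose total error probability
is at most `√(2·(1 − ε))`. -/
theorem sample_complexity_error_bound {S : Type*} [MeasurableSpace S]
    (m h : Measure S) [IsProbabilityMeasure m] [IsProbabilityMeasure h]
    (hδ : 0 < TVdist m h) (ε : ℝ) (hε : ε ∈ Set.Ico (1 / 2 : ℝ) 1)
    (n : ℕ)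
    (hn : (n : ℝ) ≥ (1 / (TVdist m h) ^ 2) * Real.log (2 / (1 - ε))) :
    ∃ A : Set (Fin n → S), MeasurableSet A ∧
      ((Measure.pi fun _ : Fin n => m) Aᶜ).toReal
        + ((Measure.pi fun _ : Fin n => h) A).toReal
        ≤ Real.sqrt (2 * (1 - ε)) := by
  obtain ⟨B, hB, hTV⟩ := exists_measurableSet_TVdist_eq m h
  set δ := TVdist m h
  obtain ⟨-, hε1⟩ := hε
  have hf : Measurable (B.indicator fun _ => (1 : ℝ)) := measurable_const.indicator hB
  have hf01 (x : S) : B.indicator (fun _ => (1 : ℝ)) x ∈ Set.Icc 0 1 := by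
    by_cases hx : x ∈ B <;> simp [hx]
  have hint (μ : Measure S) : ∫ x, B.indicator (fun _ => (1 : ℝ)) x ∂μ = μ.real B :=
    integral_indicator_one hB
  have hh := measureReal_pi_sum_ge_le_exp h hf hf01 n (t := δ / 2) (by positivity)
  have hm := measureReal_pi_sum_ge_le_exp m hf.neg (a := -1) (b := 0)
    (fun x => by simpa [and_comm] using hf01 x) n (t := δ / 2) (by positivity)
  simp only [Pi.neg_apply, integral_neg, Finset.sum_neg_distrib, hint] at hh hm
  have hexp : Real.exp (-(n * δ ^ 2 / 2)) ≤ √((1 - ε) / 2) := by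
    have hlog : Real.log (2 / (1 - ε)) ≤ n * δ ^ 2 := by
      rwa [ge_iff_le, one_div_mul_eq_div, div_le_iff₀ (by positivity)] at hn
    have hpos : 0 < (1 - ε) / 2 := by linarith
    rw [← inv_div, Real.log_inv] at hlog
    apply Real.le_sqrt_of_sq_le
    rw [← Real.exp_nat_mul, ← Real.le_log_iff_exp_le hpos]
    push_cast
    linarith
  have hsqrt : √(2 * (1 - ε)) = 2 * √((1 - ε) / 2) := by
    rw [show 2 * (1 - ε) = 2 ^ 2 * ((1 - ε) / 2) by ring,
      Real.sqrt_mul (by positivity), Real.sqrt_sq (by positivity)]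
  refine ⟨{x | n * (h.real B + δ / 2) ≤ ∑ i, B.indicator (fun _ => (1 : ℝ)) (x i)},
    measurableSet_le measurable_const
      (Finset.measurable_sum _ fun i _ => hf.comp (measurable_pi_apply i)), ?_⟩
  have hbound : Real.exp (-(2 * n * (δ / 2) ^ 2 / (1 - 0) ^ 2)) ≤ √((1 - ε) / 2) := by
    convert hexp using 2
    ring
  have hbound' : Real.exp (-(2 * n * (δ / 2) ^ 2 / (0 - -1) ^ 2)) ≤ √((1 - ε) / 2) := by
    convert hexp using 2
    ring
  rw [hsqrt, two_mul]
  refine add_le_add ((measureReal_mono fun x hx => ?_).trans (hm.trans hbound'))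
    (hh.trans hbound)
  simp only [Set.mem_compl_iff, Set.mem_ofPred_eq, not_le] at hx ⊢
  rw [show m.real B = h.real B + δ by linarith]
  linarith
end
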